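/- Let p ≥ 1 and let x ∈ ℝ^p have exactly k nonzero entries (1 ≤ k ≤ p). For every nonincreasing sequence of nonnegative weights λ = (λ₁,…,λ_p) with λ₁ > 0, one has M_λ ≥ inf_{α>0} (1/p)[ k + kα² + (p−k)·E(|Z|−α)₊² ], where Z is a standard one-dimensional Gaussian random variable and (t)₊ = max(t,0); moreover, equality holds whenever λ₁ = λ₂ = … = λ_p > 0. In other words, among all SLOPE weight sequences, M_λ is minimized by the constant (LASSO) weight sequence. -/

import Mathlib

open MeasureTheory ProbabilityTheory Filter

/-- Standard Gaussian measure `N(0, I_n)` on `ℝⁿ`. -/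
noncomputable def stdGaussian (n : ℕ) : Measure (Fin n → ℝ) :=
  Measure.pi fun _ => gaussianReal 0 1

/-- The nonincreasing rearrangement of the absolute values of the entries of `x`. -/
noncomputable def sortedAbs {n : ℕ} (x : Fin n → ℝ) : Fin n → ℝ :=
  fun i => |x ((Tuple.sort fun j => -|x j|) i)|

/-- The sorted-ℓ1 (SLOPE) norm `‖x‖_λ = ∑ λ_i |x|_(i)`. -/
noncomputable def slopeNorm {n : ℕ} (lam x : Fin n → ℝ) : ℝ :=
  ∑ i, lam i * sortedAbs x i

/-- The SLOPE proximal objective `½‖u − v‖₂² + γ‖v‖_λ`. -/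
noncomputable def slopeObj {n : ℕ} (lam : Fin n → ℝ) (γ : ℝ) (u v : Fin n → ℝ) : ℝ :=
  (1/2) * ∑ i, (u i - v i)^2 + γ * slopeNorm lam v

/-- `v` is a minimizer of the SLOPE proximal objective, i.e. `v = η(u; γ, λ)`
(the minimizer is unique since the objective is strictly convex). -/
def IsSlopeProx {n : ℕ} (lam : Fin n → ℝ) (γ : ℝ) (u v : Fin n → ℝ) : Prop :=
  ∀ w, slopeObj lam γ u v ≤ slopeObj lam γ u w

/-- The rearrangement inequality for the SLOPE norm. -/
lemma sum_mul_abs_comp_perm_le_slopeNorm {n : ℕ} {lam : Fin n → ℝ} (hlam : Antitone lam)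
    (x : Fin n → ℝ) (τ : Equiv.Perm (Fin n)) :
    ∑ i, lam i * |x (τ i)| ≤ slopeNorm lam x := by
  set σ := Tuple.sort fun j => -|x j| with hσ
  have hanti : Antitone (sortedAbs x) := fun i j hij => by
    have := Tuple.monotone_sort (fun j => -|x j|) hij
    simpa [sortedAbs] using this
  have h := (hlam.monovary hanti).sum_mul_comp_perm_le_sum_mul (σ := τ.trans σ.symm)
  simpa [slopeNorm, sortedAbs, ← hσ] using h

lemma slopeNorm_add_le {n : ℕ} {lam : Fin n → ℝ} (hlam : Antitone lam)
    (hnonneg : ∀ i, 0 ≤ lam i) (x y : Fin n → ℝ) :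
    slopeNorm lam (x + y) ≤ slopeNorm lam x + slopeNorm lam y := by
  set σ := Tuple.sort fun j => -|(x + y) j| with hσ
  calc slopeNorm lam (x + y) = ∑ i, lam i * |x (σ i) + y (σ i)| := by
        simp [slopeNorm, sortedAbs, hσ]
    _ ≤ ∑ i, (lam i * |x (σ i)| + lam i * |y (σ i)|) := by
        refine Finset.sum_le_sum fun i _ => ?_
        rw [← mul_add]
        exact mul_le_mul_of_nonneg_left (abs_add_le _ _) (hnonneg i)
    _ ≤ _ := by
        rw [Finset.sum_add_distrib]
        exact add_le_add (sum_mul_abs_comp_perm_le_slopeNorm hlam x σ)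
          (sum_mul_abs_comp_perm_le_slopeNorm hlam y σ)

lemma slopeNorm_smul_le {n : ℕ} {lam : Fin n → ℝ} (hlam : Antitone lam) {t : ℝ} (ht : 0 ≤ t)
    (x : Fin n → ℝ) : slopeNorm lam (t • x) ≤ t * slopeNorm lam x := by
  set σ := Tuple.sort fun j => -|(t • x) j| with hσ
  calc slopeNorm lam (t • x) = t * ∑ i, lam i * |x (σ i)| := by
        rw [slopeNorm, Finset.mul_sum]
        refine Finset.sum_congr rfl fun i _ => ?_
        rw [sortedAbs, ← hσ, Pi.smul_apply, smul_eq_mul, abs_mul, abs_of_nonneg ht]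
        ring
    _ ≤ _ := mul_le_mul_of_nonneg_left (sum_mul_abs_comp_perm_le_slopeNorm hlam x σ) ht

lemma slopeNorm_le_mul_sum_abs {n : ℕ} {lam : Fin n → ℝ} {c : ℝ} (hc : ∀ i, lam i ≤ c)
    (x : Fin n → ℝ) : slopeNorm lam x ≤ c * ∑ i, |x i| := by
  rw [← Equiv.sum_comp (Tuple.sort fun j => -|x j|) fun i => |x i|, Finset.mul_sum]
  exact Finset.sum_le_sum fun i _ => mul_le_mul_of_nonneg_right (hc i) (abs_nonneg _)

lemma slopeNorm_eq_mul_sum_abs {n : ℕ} {lam : Fin n → ℝ} {c : ℝ} (hc : ∀ i, lam i = c)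
    (x : Fin n → ℝ) : slopeNorm lam x = c * ∑ i, |x i| := by
  rw [← Equiv.sum_comp (Tuple.sort fun j => -|x j|) fun i => |x i|, Finset.mul_sum]
  exact Finset.sum_congr rfl fun i _ => by rw [hc i]; rfl

/-- The subgradient inequality satisfied by the SLOPE proximal point. -/
lemma IsSlopeProx.sum_mul_le {n : ℕ} {lam : Fin n → ℝ} (hlam : Antitone lam)
    (hnonneg : ∀ i, 0 ≤ lam i) {γ : ℝ} (hγ : 0 ≤ γ) {u v : Fin n → ℝ}
    (h : IsSlopeProx lam γ u v) (w : Fin n → ℝ) :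
    ∑ i, (u i - v i) * (w i - v i) ≤ γ * (slopeNorm lam w - slopeNorm lam v) := by
  set S := ∑ i, (w i - v i) ^ 2 with hS
  have hS0 : 0 ≤ S := Finset.sum_nonneg fun i _ => sq_nonneg _
  have key : ∀ t : ℝ, 0 < t → t < 1 → ∑ i, (u i - v i) * (w i - v i) ≤
      γ * (slopeNorm lam w - slopeNorm lam v) + t * S := by
    intro t ht ht1
    have h1 := h ((1 - t) • v + t • w)
    have h2 : slopeNorm lam ((1 - t) • v + t • w) ≤
        (1 - t) * slopeNorm lam v + t * slopeNorm lam w :=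
      (slopeNorm_add_le hlam hnonneg _ _).trans
        (add_le_add (slopeNorm_smul_le hlam (by linarith) _) (slopeNorm_smul_le hlam ht.le _))
    have h3 : ∑ i, (u i - ((1 - t) • v + t • w) i) ^ 2 =
        ∑ i, (u i - v i) ^ 2 - 2 * t * ∑ i, (u i - v i) * (w i - v i) + t ^ 2 * S := by
      rw [hS, Finset.mul_sum, Finset.mul_sum, ← Finset.sum_sub_distrib, ← Finset.sum_add_distrib]
      refine Finset.sum_congr rfl fun i _ => ?_
      simp only [Pi.add_apply, Pi.smul_apply, smul_eq_mul]
      ring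
    have h4 := mul_le_mul_of_nonneg_left h2 hγ
    simp only [slopeObj, h3] at h1
    have h5 : 0 ≤ t * S := mul_nonneg ht.le hS0
    have h6 : 0 ≤ t * (γ * (slopeNorm lam w - slopeNorm lam v) + t * S -
        ∑ i, (u i - v i) * (w i - v i)) := by nlinarith
    linarith [nonneg_of_mul_nonneg_right h6 ht]
  refine le_of_forall_pos_le_add fun ε hε => ?_
  have hS1 : 0 < S + 1 := by linarith
  have ht : 0 < min (1 / 2) (ε / (S + 1)) := lt_min (by norm_num) (div_pos hε hS1)
  refine (key _ ht ((min_le_left _ _).trans_lt (by norm_num))).trans ?_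
  gcongr
  calc min (1 / 2) (ε / (S + 1)) * S ≤ ε / (S + 1) * (S + 1) :=
        mul_le_mul (min_le_right _ _) (by linarith) hS0 (div_pos hε hS1).le
    _ = ε := div_mul_cancel₀ _ hS1.ne'

/-- The residual of the SLOPE proximal point lies in the sup-norm ball. -/
lemma IsSlopeProx.abs_sub_le {n : ℕ} {lam : Fin n → ℝ} (hlam : Antitone lam)
    (hnonneg : ∀ i, 0 ≤ lam i) {γ c : ℝ} (hγ : 0 ≤ γ) (hc : ∀ i, lam i ≤ c) {u v : Fin n → ℝ}
    (h : IsSlopeProx lam γ u v) (i : Fin n) : |u i - v i| ≤ γ * c := by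
  have key : ∀ s : ℝ, (u i - v i) * s ≤ γ * (c * |s|) := by
    intro s
    have h1 := h.sum_mul_le hlam hnonneg hγ (v + Pi.single i s)
    have h2 := slopeNorm_add_le hlam hnonneg v (Pi.single i s)
    have h3 := slopeNorm_le_mul_sum_abs hc (Pi.single i s)
    have h4 : ∑ j, |(Pi.single i s : Fin n → ℝ) j| = |s| := by
      rw [Finset.sum_eq_single i (fun j _ hj => by simp [hj]) (by simp)]
      simp
    have h5 : ∑ j, (u j - v j) * ((v + Pi.single i s : Fin n → ℝ) j - v j) = (u i - v i) * s := by
      rw [Finset.sum_eq_single i (fun j _ hj => by simp [hj]) (by simp)]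
      simp
    rw [h4] at h3
    rw [h5] at h1
    exact h1.trans (mul_le_mul_of_nonneg_left (by linarith) hγ)
  have h1 := key 1
  have h2 := key (-1)
  simp only [abs_neg, abs_one, mul_one] at h1 h2
  exact abs_le.2 ⟨by linarith, by linarith⟩

lemma IsSlopeProx.softThreshold_sq_le {n : ℕ} {lam : Fin n → ℝ} (hlam : Antitone lam)
    (hnonneg : ∀ i, 0 ≤ lam i) {γ c : ℝ} (hγ : 0 ≤ γ) (hc : ∀ i, lam i ≤ c) {u v : Fin n → ℝ}
    (h : IsSlopeProx lam γ u v) (i : Fin n) : (max (|u i| - γ * c) 0) ^ 2 ≤ v i ^ 2 := by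
  have h1 := h.abs_sub_le hlam hnonneg hγ hc i
  have h2 := abs_sub_abs_le_abs_sub (u i) (v i)
  rw [← sq_abs (v i)]
  exact pow_le_pow_left₀ (le_max_right _ _) (max_le (by linarith) (abs_nonneg _)) 2

/-- With constant weights, the SLOPE proximal operator is soft thresholding. -/
lemma IsSlopeProx.sq_eq_softThreshold_sq {n : ℕ} {lam : Fin n → ℝ} {γ c : ℝ} (hγ : 0 ≤ γ)
    (hc0 : 0 ≤ c) (hc : ∀ i, lam i = c) {u v : Fin n → ℝ}
    (h : IsSlopeProx lam γ u v) (i : Fin n) : v i ^ 2 = (max (|u i| - γ * c) 0) ^ 2 := by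
  have hlam : Antitone lam := fun a b _ => by rw [hc a, hc b]
  have hnonneg : ∀ i, 0 ≤ lam i := fun i => by rw [hc i]; exact hc0
  refine le_antisymm ?_ (h.softThreshold_sq_le hlam hnonneg hγ (fun i => (hc i).le) i)
  have h1 := h.sum_mul_le hlam hnonneg hγ (Function.update v i 0)
  have h2 : ∑ j, (u j - v j) * (Function.update v i 0 j - v j) = -((u i - v i) * v i) := by
    rw [Finset.sum_eq_single i (fun j _ hj => by simp [hj]) (by simp)]
    simp
  have h3 : ∑ j, |Function.update v i 0 j| - ∑ j, |v j| = -|v i| := by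
    rw [← Finset.sum_sub_distrib,
      Finset.sum_eq_single i (fun j _ hj => by simp [hj]) (by simp)]
    simp
  rw [h2, slopeNorm_eq_mul_sum_abs hc, slopeNorm_eq_mul_sum_abs hc, ← mul_sub, h3] at h1
  have h4 : u i * v i ≤ |u i| * |v i| := by rw [← abs_mul]; exact le_abs_self _
  rw [← sq_abs (v i)]
  refine pow_le_pow_left₀ (abs_nonneg _) ?_ 2
  rcases (abs_nonneg (v i)).eq_or_lt with h0 | h0
  · rw [← h0]
    exact le_max_right _ _
  · refine le_max_of_le_left ?_
    have h5 : |v i| ^ 2 = v i * v i := by rw [sq_abs, sq]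
    have h6 : 0 ≤ |v i| * (|u i| - γ * c - |v i|) := by nlinarith
    linarith [nonneg_of_mul_nonneg_right h6 h0]

/-- The SLOPE proximal operator is nonexpansive. -/
lemma IsSlopeProx.sum_sub_sq_le {n : ℕ} {lam : Fin n → ℝ} (hlam : Antitone lam)
    (hnonneg : ∀ i, 0 ≤ lam i) {γ : ℝ} (hγ : 0 ≤ γ) {u v u' v' : Fin n → ℝ}
    (h : IsSlopeProx lam γ u v) (h' : IsSlopeProx lam γ u' v') :
    ∑ i, (v i - v' i) ^ 2 ≤ ∑ i, (u i - u' i) ^ 2 := by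
  have h1 := h.sum_mul_le hlam hnonneg hγ v'
  have h2 := h'.sum_mul_le hlam hnonneg hγ v
  have h3 : 2 * ∑ i, (v i - v' i) ^ 2 + 2 * (-(∑ i, (u i - v i) * (v' i - v i) +
      ∑ i, (u' i - v' i) * (v i - v' i))) ≤ ∑ i, (v i - v' i) ^ 2 + ∑ i, (u i - u' i) ^ 2 := by
    rw [← Finset.sum_add_distrib, ← Finset.sum_neg_distrib, Finset.mul_sum, Finset.mul_sum,
      ← Finset.sum_add_distrib, ← Finset.sum_add_distrib]
    exact Finset.sum_le_sum fun i _ => by nlinarith [sq_nonneg ((v i - v' i) - (u i - u' i))]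
  linarith

lemma continuous_of_isSlopeProx {n : ℕ} {lam : Fin n → ℝ} (hlam : Antitone lam)
    (hnonneg : ∀ i, 0 ≤ lam i) {γ : ℝ} (hγ : 0 ≤ γ) {η : (Fin n → ℝ) → Fin n → ℝ}
    (h : ∀ u, IsSlopeProx lam γ u (η u)) : Continuous η := by
  refine continuous_pi fun i => continuous_iff_continuousAt.2 fun u => ?_
  have hlim : Tendsto (fun w : Fin n → ℝ => √(∑ j, (w j - u j) ^ 2)) (nhds u) (nhds 0) := by
    have : Continuous fun w : Fin n → ℝ => √(∑ j, (w j - u j) ^ 2) := by fun_prop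
    simpa using this.tendsto u
  refine tendsto_iff_dist_tendsto_zero.2 (squeeze_zero (fun _ => dist_nonneg) (fun w => ?_) hlim)
  rw [Real.dist_eq]
  refine Real.abs_le_sqrt (le_trans ?_ ((h w).sum_sub_sq_le hlam hnonneg hγ (h u)))
  exact Finset.single_le_sum (f := fun j => (η w j - η u j) ^ 2) (fun j _ => sq_nonneg _)
    (Finset.mem_univ i)

instance (n : ℕ) : IsProbabilityMeasure (_root_.stdGaussian n) := by
  unfold _root_.stdGaussian
  infer_instance

lemma measurePreserving_eval_stdGaussian {n : ℕ} (i : Fin n) :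
    MeasurePreserving (Function.eval i) (_root_.stdGaussian n) (gaussianReal 0 1) :=
  measurePreserving_eval (fun _ : Fin n => gaussianReal 0 1) i

lemma integrable_sq_gaussianReal : Integrable (fun z : ℝ => z ^ 2) (gaussianReal 0 1) :=
  (memLp_id_gaussianReal 2).integrable_sq

lemma integrable_softThreshold_sq (t : ℝ) :
    Integrable (fun z : ℝ => (max (|z| - t) 0) ^ 2) (gaussianReal 0 1) := by
  refine Integrable.mono' ((integrable_sq_gaussianReal.const_mul 2).add
    (integrable_const (2 * t ^ 2))) (by fun_prop) (ae_of_all _ fun z => ?_)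
  rw [Real.norm_of_nonneg (sq_nonneg _)]
  simp only [Pi.add_apply]
  rcases le_total (|z| - t) 0 with h | h
  · rw [max_eq_right h]
    nlinarith [sq_nonneg z, sq_nonneg t]
  · rw [max_eq_left h]
    nlinarith [sq_abs z, sq_nonneg (|z| + t)]

lemma integral_sum_comp_eval_stdGaussian (n : ℕ) {f : ℝ → ℝ}
    (hf : Integrable f (gaussianReal 0 1)) :
    Integrable (fun u : Fin n → ℝ => ∑ i, f (u i)) (_root_.stdGaussian n) ∧
      ∫ u, ∑ i, f (u i) ∂_root_.stdGaussian n = n * ∫ z, f z ∂gaussianReal 0 1 := by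
  have hi : ∀ i : Fin n, Integrable (fun u : Fin n → ℝ => f (u i)) (_root_.stdGaussian n) :=
    fun i => (measurePreserving_eval_stdGaussian i).integrable_comp_of_integrable hf
  refine ⟨integrable_finsetSum _ fun i _ => hi i, ?_⟩
  rw [integral_finsetSum _ fun i _ => hi i]
  have he : ∀ i : Fin n, ∫ u, f (u i) ∂_root_.stdGaussian n = ∫ z, f z ∂gaussianReal 0 1 := by
    intro i
    have hm := measurePreserving_eval_stdGaussian i
    rw [← hm.map_eq] at hf ⊢
    exact (integral_map hm.measurable.aemeasurable hf.aestronglyMeasurable).symm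
  simp [he]

lemma integrable_sum_sq_of_isSlopeProx {n : ℕ} {lam : Fin n → ℝ} (hlam : Antitone lam)
    (hnonneg : ∀ i, 0 ≤ lam i) {γ c : ℝ} (hγ : 0 ≤ γ) (hc : ∀ i, lam i ≤ c)
    {η : (Fin n → ℝ) → Fin n → ℝ} (h : ∀ u, IsSlopeProx lam γ u (η u)) :
    Integrable (fun u => ∑ i, η u i ^ 2) (_root_.stdGaussian n) := by
  have hcont := continuous_of_isSlopeProx hlam hnonneg hγ h
  refine Integrable.mono' (integral_sum_comp_eval_stdGaussian n
    ((integrable_sq_gaussianReal.const_mul 2).add (integrable_const (2 * (γ * c) ^ 2)))).1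
    (Continuous.aestronglyMeasurable (by fun_prop)) (ae_of_all _ fun u => ?_)
  rw [Real.norm_of_nonneg (Finset.sum_nonneg fun i _ => sq_nonneg _)]
  refine Finset.sum_le_sum fun i _ => ?_
  have h1 := (h u).abs_sub_le hlam hnonneg hγ hc i
  have h2 := pow_le_pow_left₀ (abs_nonneg _) h1 2
  rw [sq_abs] at h2
  simp only [Pi.add_apply]
  nlinarith [sq_nonneg (η u i - 2 * u i)]

/-- among all SLOPE weight sequences, `M_λ` is minimized by the
constant (LASSO) weight sequence: `M_λ ≥ inf_{α>0} (1/p)[k + kα² + (p−k)E(|Z|−α)₊²]`,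
with equality for constant weights. -/
theorem lasso_minimizes_M
    (p k : ℕ) (hp : 1 ≤ p) (hk1 : 1 ≤ k) (hkp : k ≤ p)
    (x : Fin p → ℝ)
    (hxk : {i : Fin p | x i ≠ 0}.ncard = k)
    (lam : Fin p → ℝ)
    (hmono : ∀ i j : Fin p, i ≤ j → lam j ≤ lam i)
    (hnonneg : ∀ i, 0 ≤ lam i)
    (hlam1 : 0 < lam ⟨0, hp⟩)
    (lamq : Fin (p - k) → ℝ)
    (hlamq : ∀ i : Fin (p - k), lamq i = lam ⟨k + i.val, by have := i.isLt; omega⟩)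
    (ηq : ℝ → (Fin (p - k) → ℝ) → (Fin (p - k) → ℝ))
    (hηq : ∀ γ u, 0 ≤ γ → IsSlopeProx lamq γ u (ηq γ u))
    (M : ℝ)
    (hM : M = (1 / (p : ℝ)) * sInf {m : ℝ | ∃ α : ℝ, 0 < α ∧
      m = (k : ℝ) + α ^ 2 * (∑ i : Fin p, if (i : ℕ) < k then lam i ^ 2 else 0)
        + ∫ ht, (∑ i, (ηq α ht i) ^ 2) ∂ stdGaussian (p - k)})
    (L : ℝ)
    (hL : L = sInf {m : ℝ | ∃ α : ℝ, 0 < α ∧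
      m = (1 / (p : ℝ)) * ((k : ℝ) + (k : ℝ) * α ^ 2
        + ((p : ℝ) - (k : ℝ)) * ∫ z, (max (|z| - α) 0) ^ 2 ∂ gaussianReal 0 1)}) :
    L ≤ M ∧ ((∀ i j : Fin p, lam i = lam j) → M = L) := by
  set G : ℝ → ℝ := fun t => ∫ z, (max (|z| - t) 0) ^ 2 ∂gaussianReal 0 1 with hG
  have hp0 : (0 : ℝ) < p := by exact_mod_cast hp
  have hcast : ((p - k : ℕ) : ℝ) = (p : ℝ) - k := Nat.cast_sub hkp
  have hpk : (0 : ℝ) ≤ (p : ℝ) - k := hcast ▸ Nat.cast_nonneg _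
  have hG0 : ∀ t, 0 ≤ G t := fun t => integral_nonneg fun z => sq_nonneg _
  set c : ℝ := lam ⟨k - 1, by omega⟩ with hcdef
  have hc0 : 0 ≤ c := hnonneg _
  have hanti : Antitone lamq := fun i j hij => by
    rw [hlamq, hlamq]
    exact hmono _ _ (by simpa using hij)
  have hqnonneg : ∀ i, 0 ≤ lamq i := fun i => by rw [hlamq]; exact hnonneg _
  have hqc : ∀ i, lamq i ≤ c := fun i => by
    rw [hlamq]
    exact hmono _ _ (by simp only [Fin.mk_le_mk]; omega)
  have hcard : ∀ a : ℝ, (∑ i : Fin p, if (i : ℕ) < k then a else 0) = k * a := by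
    intro a
    rw [Fin.sum_univ_eq_sum_range (fun i => if i < k then a else 0) p, ← Finset.sum_filter,
      show (Finset.range p).filter (· < k) = Finset.range k by ext i; simp; omega]
    simp
  have hLle : ∀ t, 0 < t → L ≤ 1 / p * (k + k * t ^ 2 + (p - k) * G t) := by
    intro t ht
    rw [hL]
    refine csInf_le ⟨0, ?_⟩ ⟨t, ht, rfl⟩
    rintro _ ⟨s, -, rfl⟩
    have := mul_nonneg hpk (hG0 s)
    positivity
  have hLle' : ∀ t, 0 ≤ t → p * L ≤ k + k * t ^ 2 + (p - k) * G t := by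
    intro t ht
    have hmul : ∀ s, 0 < s → p * L ≤ k + k * s ^ 2 + (p - k) * G s := fun s hs => by
      have := mul_le_mul_of_nonneg_left (hLle s hs) hp0.le
      rwa [← mul_assoc, mul_one_div_cancel hp0.ne', one_mul] at this
    rcases ht.eq_or_lt with rfl | ht
    · have hlim : Tendsto (fun s : ℝ => (k : ℝ) + k * s ^ 2 + (p - k) * G 0)
          (nhdsWithin 0 (Set.Ioi 0)) (nhds (k + k * 0 ^ 2 + (p - k) * G 0)) := by
        refine Tendsto.mono_left (Continuous.tendsto ?_ 0) nhdsWithin_le_nhds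
        fun_prop
      refine ge_of_tendsto hlim (eventually_mem_nhdsWithin.mono fun s (hs : 0 < s) => ?_)
      have hGs : G s ≤ G 0 := integral_mono (integrable_softThreshold_sq s)
        (integrable_softThreshold_sq 0) fun z => by
          simp only
          gcongr
      have := mul_le_mul_of_nonneg_left hGs hpk
      linarith [hmul s hs]
    · exact hmul t ht
  refine ⟨?_, fun hconst => ?_⟩
  · have hle : p * L ≤ sInf {m : ℝ | ∃ α : ℝ, 0 < α ∧
        m = (k : ℝ) + α ^ 2 * (∑ i : Fin p, if (i : ℕ) < k then lam i ^ 2 else 0)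
          + ∫ ht, (∑ i, (ηq α ht i) ^ 2) ∂_root_.stdGaussian (p - k)} := by
      refine le_csInf ⟨_, 1, one_pos, rfl⟩ ?_
      rintro _ ⟨α, hα, rfl⟩
      have hint := integral_sum_comp_eval_stdGaussian (p - k)
        (integrable_softThreshold_sq (α * c))
      have h1 : (p - k) * G (α * c) ≤
          ∫ ht, (∑ i, (ηq α ht i) ^ 2) ∂_root_.stdGaussian (p - k) := by
        rw [← hcast, ← hint.2]
        exact integral_mono hint.1 (integrable_sum_sq_of_isSlopeProx hanti hqnonneg hα.le hqc
          fun u => hηq α u hα.le) fun u => Finset.sum_le_sum fun i _ =>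
            (hηq α u hα.le).softThreshold_sq_le hanti hqnonneg hα.le hqc i
      have h2 : k * c ^ 2 ≤ ∑ i : Fin p, if (i : ℕ) < k then lam i ^ 2 else 0 := by
        rw [← hcard]
        refine Finset.sum_le_sum fun i _ => ?_
        split_ifs with hi
        · exact pow_le_pow_left₀ hc0 (hmono _ _ (Fin.le_def.2 (by simp only; omega))) 2
        · exact le_rfl
      have h3 := mul_le_mul_of_nonneg_left h2 (sq_nonneg α)
      have h4 := hLle' (α * c) (mul_nonneg hα.le hc0)
      have h5 : (k : ℝ) * (α * c) ^ 2 = α ^ 2 * (k * c ^ 2) := by ring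
      linarith
    rw [hM, one_div, ← div_eq_inv_mul, le_div_iff₀ hp0, mul_comm]
    exact hle
  · have hlamc : ∀ i, lam i = c := fun i => hconst _ _
    have hcpos : 0 < c := hlamc ⟨0, hp⟩ ▸ hlam1
    have hset : ∀ α : ℝ, 0 < α →
        (k : ℝ) + α ^ 2 * (∑ i : Fin p, if (i : ℕ) < k then lam i ^ 2 else 0)
          + ∫ ht, (∑ i, (ηq α ht i) ^ 2) ∂_root_.stdGaussian (p - k) =
        k + k * (α * c) ^ 2 + (p - k) * G (α * c) := by
      intro α hα
      have h1 : ∀ u i, ηq α u i ^ 2 = (max (|u i| - α * c) 0) ^ 2 := fun u i =>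
        (hηq α u hα.le).sq_eq_softThreshold_sq hα.le hc0
          (fun i => by rw [hlamq, hlamc]) i
      simp only [h1, hlamc, hcard, (integral_sum_comp_eval_stdGaussian (p - k)
        (integrable_softThreshold_sq (α * c))).2, hcast, hG]
      ring
    rw [hM, hL, ← smul_eq_mul, ← Real.sInf_smul_of_nonneg (by positivity)]
    congr 1
    ext m
    simp only [Set.mem_smul_set, Set.mem_ofPred_eq, smul_eq_mul]
    constructor
    · rintro ⟨_, ⟨α, hα, rfl⟩, rfl⟩
      exact ⟨α * c, mul_pos hα hcpos, by rw [hset α hα]⟩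
    · rintro ⟨α, hα, rfl⟩
      refine ⟨_, ⟨α / c, div_pos hα hcpos, rfl⟩, ?_⟩
      rw [hset _ (div_pos hα hcpos), div_mul_cancel₀ _ hcpos.ne']
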